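/- arXiv:1310.2187 — 4 statements merged into one kernel-verified Lean document; each statement's English description precedes it below -/
import Mathlib

section
/- Let T be a densely defined skew-adjoint operator on a complex Hilbert space X (T* = −T) and let R ∈ L(X) satisfy R* = −R. Then the operator S on the Hilbert space direct sum X ⊕ X with domain D(S) = {(x₁, x₂) : x₁ − x₂ ∈ D(T)} defined by S(x₁, x₂) = (−T(x₁ − x₂) − x₂, T(x₁ − x₂) + x₁ + R x₂) is skew-adjoint: S* = −S. -/
/-- A densely defined skew-symmetric operator is skew-adjoint as soon as the domain of its adjoint
is contained in its own domain. -/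
theorem LinearPMap.adjoint_eq_neg_of_skewSymmetric {E : Type*} [NormedAddCommGroup E]
    [InnerProductSpace ℂ E] [CompleteSpace E] {S : E →ₗ.[ℂ] E}
    (hS : Dense (S.domain : Set E))
    (hskew : ∀ x y : S.domain, inner ℂ (S x) (y : E) = -inner ℂ (x : E) (S y))
    (hdom : ∀ y w : E, (∀ x : S.domain, inner ℂ w (x : E) = inner ℂ y (S x)) → y ∈ S.domain) :
    S.adjoint = -S := by
  have hformal : S.IsFormalAdjoint (-S) := fun x y => by
    rw [LinearPMap.neg_apply, inner_neg_right]
    exact hskew x y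
  refine (LinearPMap.eq_of_le_of_domain_eq (hformal.le_adjoint hS) ?_).symm
  refine le_antisymm (hformal.le_adjoint hS).1 fun y hy => ?_
  exact hdom y (S.adjoint ⟨y, hy⟩) fun x => S.adjoint_isFormalAdjoint hS ⟨y, hy⟩ x

/-- An operator whose adjoint is its negative is skew-symmetric. -/
theorem LinearPMap.inner_apply_eq_neg_of_adjoint_eq_neg {E : Type*} [NormedAddCommGroup E]
    [InnerProductSpace ℂ E] [CompleteSpace E] {T : E →ₗ.[ℂ] E}
    (hdense : Dense (T.domain : Set E)) (hT : T.adjoint = -T) (x y : T.domain) :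
    inner ℂ (T x) (y : E) = -inner ℂ (x : E) (T y) := by
  have h := T.adjoint_isFormalAdjoint hdense
  rw [hT] at h
  have hxy := h x y
  rw [LinearPMap.neg_apply, inner_neg_left] at hxy
  exact neg_eq_iff_eq_neg.mp hxy

/-- Pairs whose difference lies in a dense set are dense in the Hilbert direct sum. -/
theorem WithLp.dense_setOf_fst_sub_snd_mem {X : Type*} [NormedAddCommGroup X]
    [InnerProductSpace ℂ X] [CompleteSpace X] {D : Set X} (hD : Dense D) :
    Dense {v : WithLp 2 (X × X) | v.fst - v.snd ∈ D} := by
  let J : WithLp 2 (X × X) →L[ℂ] X :=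
    (ContinuousLinearMap.fst ℂ X X - ContinuousLinearMap.snd ℂ X X).comp
      (WithLp.prodContinuousLinearEquiv 2 ℂ X X).toContinuousLinearMap
  have hJ : Function.Surjective J := fun x => ⟨WithLp.toLp 2 (x, 0), by simp [J]⟩
  exact hD.preimage (J.isOpenMap hJ)

/-- **Skew-adjointness of the model block operator `[[−T, T−I],[T+I, −T+R]]`.**
Let `T` be a densely defined skew-adjoint operator on a complex Hilbert space `X`
(`T* = −T`) and let `R` be a bounded operator on `X` with `R* = −R`.  Then the operator
`S` on the Hilbert direct sum `X ⊕ X` (realized as `WithLp 2 (X × X)`) with domain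
`D(S) = {(x₁,x₂) : x₁ − x₂ ∈ D(T)}` defined by
`S (x₁, x₂) = (−T(x₁−x₂) − x₂, T(x₁−x₂) + x₁ + R x₂)` is skew-adjoint: `S* = −S`. -/
theorem block_operator_skewAdjoint
    {X : Type*} [NormedAddCommGroup X] [InnerProductSpace ℂ X] [CompleteSpace X]
    (T : X →ₗ.[ℂ] X) (hTdense : Dense (T.domain : Set X)) (hT : T.adjoint = -T)
    (R : X →L[ℂ] X) (hR : ContinuousLinearMap.adjoint R = -R)
    (S : WithLp 2 (X × X) →ₗ.[ℂ] WithLp 2 (X × X))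
    (hSdom : ∀ v : WithLp 2 (X × X), v ∈ S.domain ↔
      (WithLp.equiv 2 (X × X) v).1 - (WithLp.equiv 2 (X × X) v).2 ∈ T.domain)
    (hSval : ∀ (v : WithLp 2 (X × X)) (hv : v ∈ S.domain)
      (h : (WithLp.equiv 2 (X × X) v).1 - (WithLp.equiv 2 (X × X) v).2 ∈ T.domain),
      S ⟨v, hv⟩ = (WithLp.equiv 2 (X × X)).symm
        (-(T ⟨(WithLp.equiv 2 (X × X) v).1 - (WithLp.equiv 2 (X × X) v).2, h⟩)
            - (WithLp.equiv 2 (X × X) v).2,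
          T ⟨(WithLp.equiv 2 (X × X) v).1 - (WithLp.equiv 2 (X × X) v).2, h⟩
            + (WithLp.equiv 2 (X × X) v).1 + R ((WithLp.equiv 2 (X × X) v).2))) :
    S.adjoint = -S := by
  simp only [WithLp.equiv_apply, WithLp.equiv_symm_apply] at hSdom hSval
  have hRskew : ∀ a b : X, inner ℂ (R a) b = -inner ℂ a (R b) := fun a b => by
    rw [← ContinuousLinearMap.adjoint_inner_right, hR, neg_apply,
      inner_neg_right]
  refine LinearPMap.adjoint_eq_neg_of_skewSymmetric ?_ ?_ ?_
  · exact (WithLp.dense_setOf_fst_sub_snd_mem hTdense).mono fun v hv => (hSdom v).mpr hv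
  · rintro ⟨x, hx⟩ ⟨y, hy⟩
    have hT' := LinearPMap.inner_apply_eq_neg_of_adjoint_eq_neg hTdense hT
      ⟨_, (hSdom x).mp hx⟩ ⟨_, (hSdom y).mp hy⟩
    rw [hSval x hx ((hSdom x).mp hx), hSval y hy ((hSdom y).mp hy)]
    simp only [WithLp.prod_inner_apply, inner_add_left, inner_add_right, inner_sub_left,
      inner_sub_right, inner_neg_left, inner_neg_right, hRskew] at hT' ⊢
    linear_combination -hT'
  · intro y w h
    rw [hSdom]
    change y.ofLp.1 - y.ofLp.2 ∈ (-T).domain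
    rw [← hT]
    refine T.mem_adjoint_domain_of_exists _ ⟨y.ofLp.2 - w.ofLp.1, fun d => ?_⟩
    have hmem : (WithLp.toLp 2 ((d : X), (0 : X))).ofLp.1 -
        (WithLp.toLp 2 ((d : X), (0 : X))).ofLp.2 ∈ T.domain := by simp
    have hd := h ⟨WithLp.toLp 2 ((d : X), (0 : X)), (hSdom _).mpr hmem⟩
    rw [hSval _ _ hmem] at hd
    simp only [WithLp.prod_inner_apply, sub_zero, inner_add_right, inner_neg_right,
      inner_zero_right, add_zero, map_zero, inner_sub_left] at hd ⊢
    linear_combination -hd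
end

section
/- Let X and U be complex Hilbert spaces and let [[A,B],[C,D]] : X ⊕ U → X ⊕ U be a unitary colligation matrix such that I_U − D is boundedly invertible. Then the operator U₀ := A + B (I − D)^{-1} C ∈ L(X) is unitary. -/
/-- The block operator (colligation matrix) `[[A,B],[C,D]]` on the Hilbert direct sum
`X ⊕ U`, realized via `WithLp 2` products. -/
noncomputable def colligation10 {X U Y V : Type*}
    [NormedAddCommGroup X] [InnerProductSpace ℂ X]
    [NormedAddCommGroup U] [InnerProductSpace ℂ U]
    [NormedAddCommGroup Y] [InnerProductSpace ℂ Y]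
    [NormedAddCommGroup V] [InnerProductSpace ℂ V]
    (A : X →L[ℂ] Y) (B : U →L[ℂ] Y) (C : X →L[ℂ] V) (D : U →L[ℂ] V) :
    WithLp 2 (X × U) →L[ℂ] WithLp 2 (Y × V) :=
  (((WithLp.prodContinuousLinearEquiv 2 ℂ Y V).symm : (Y × V) →L[ℂ] WithLp 2 (Y × V)) ∘L
    (((A ∘L ContinuousLinearMap.fst ℂ X U) + (B ∘L ContinuousLinearMap.snd ℂ X U)).prod
      ((C ∘L ContinuousLinearMap.fst ℂ X U) + (D ∘L ContinuousLinearMap.snd ℂ X U)))) ∘L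
    ((WithLp.prodContinuousLinearEquiv 2 ℂ X U) : WithLp 2 (X × U) →L[ℂ] (X × U))

open ContinuousLinearMap in
/-- The adjoint of a block operator is the transposed block operator of the adjoints. -/
theorem adjoint_colligation10 {X U Y V : Type*}
    [NormedAddCommGroup X] [InnerProductSpace ℂ X] [CompleteSpace X]
    [NormedAddCommGroup U] [InnerProductSpace ℂ U] [CompleteSpace U]
    [NormedAddCommGroup Y] [InnerProductSpace ℂ Y] [CompleteSpace Y]
    [NormedAddCommGroup V] [InnerProductSpace ℂ V] [CompleteSpace V]
    (A : X →L[ℂ] Y) (B : U →L[ℂ] Y) (C : X →L[ℂ] V) (D : U →L[ℂ] V) :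
    adjoint (colligation10 A B C D) =
      colligation10 (adjoint A) (adjoint C) (adjoint B) (adjoint D) := by
  symm
  rw [eq_adjoint_iff]
  intro x y
  simp only [colligation10, WithLp.prod_inner_apply, coe_comp, Function.comp_apply,
    ContinuousLinearEquiv.coe_coe, WithLp.prodContinuousLinearEquiv_apply,
    WithLp.prodContinuousLinearEquiv_symm_apply, prod_apply, add_apply, coe_fst', coe_snd',
    inner_add_left, inner_add_right, adjoint_inner_left]
  ring

/-- The defining property of the Schur complement: closing the `U`-port of a colligation. -/
theorem colligation10_schur_complement {X U Y : Type*}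
    [NormedAddCommGroup X] [InnerProductSpace ℂ X]
    [NormedAddCommGroup U] [InnerProductSpace ℂ U]
    [NormedAddCommGroup Y] [InnerProductSpace ℂ Y]
    (A : X →L[ℂ] Y) (B : U →L[ℂ] Y) (C : X →L[ℂ] U) (D : U →L[ℂ] U)
    (hD : IsUnit ((1 : U →L[ℂ] U) - D)) (x : X) (y : Y) (u : U) :
    colligation10 A B C D (WithLp.toLp 2 (x, u)) = WithLp.toLp 2 (y, u) ↔
      u = Ring.inverse ((1 : U →L[ℂ] U) - D) (C x) ∧
        y = (A + B ∘L Ring.inverse ((1 : U →L[ℂ] U) - D) ∘L C) x := by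
  have hleft (w : U) : Ring.inverse ((1 : U →L[ℂ] U) - D) (((1 : U →L[ℂ] U) - D) w) = w :=
    DFunLike.congr_fun (Ring.inverse_mul_cancel _ hD) w
  have hright (w : U) : ((1 : U →L[ℂ] U) - D) (Ring.inverse ((1 : U →L[ℂ] U) - D) w) = w :=
    DFunLike.congr_fun (Ring.mul_inverse_cancel _ hD) w
  have hport : C x + D u = u ↔ u = Ring.inverse ((1 : U →L[ℂ] U) - D) (C x) := by
    constructor
    · intro h
      rw [← hleft u]
      congr 1
      simpa [sub_eq_iff_eq_add] using h.symm
    · intro h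
      have := hright (C x)
      rw [← h] at this
      simp [← this]
  have hblock : colligation10 A B C D (WithLp.toLp 2 (x, u)) =
      WithLp.toLp 2 (A x + B u, C x + D u) := rfl
  rw [hblock, (WithLp.toLp_injective 2).eq_iff, Prod.mk.injEq, hport, and_comm]
  refine and_congr_right fun h => ?_
  rw [h, eq_comm]
  rfl

/-- **The Redheffer/Schur-complement rotation of a unitary colligation is unitary.**
If `[[A,B],[C,D]] : X ⊕ U → X ⊕ U` is a unitary colligation matrix and `I − D` is
boundedly invertible, then `U₀ := A + B (I − D)⁻¹ C` is a unitary operator on `X`. -/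
theorem schur_complement_rotation_unitary
    {X U : Type*} [NormedAddCommGroup X] [InnerProductSpace ℂ X] [CompleteSpace X]
    [NormedAddCommGroup U] [InnerProductSpace ℂ U] [CompleteSpace U]
    (A : X →L[ℂ] X) (B : U →L[ℂ] X) (C : X →L[ℂ] U) (D : U →L[ℂ] U)
    (hU1 : ContinuousLinearMap.adjoint (colligation10 A B C D) ∘L colligation10 A B C D = 1)
    (hU2 : colligation10 A B C D ∘L ContinuousLinearMap.adjoint (colligation10 A B C D) = 1)
    (hD : IsUnit ((1 : U →L[ℂ] U) - D)) :
    ContinuousLinearMap.adjoint (A + B ∘L Ring.inverse ((1 : U →L[ℂ] U) - D) ∘L C) *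
        (A + B ∘L Ring.inverse ((1 : U →L[ℂ] U) - D) ∘L C) = 1 ∧
    (A + B ∘L Ring.inverse ((1 : U →L[ℂ] U) - D) ∘L C) *
        ContinuousLinearMap.adjoint (A + B ∘L Ring.inverse ((1 : U →L[ℂ] U) - D) ∘L C) = 1 := by
  set T := A + B ∘L Ring.inverse ((1 : U →L[ℂ] U) - D) ∘L C
  have hiso : ContinuousLinearMap.adjoint T * T = 1 := by
    refine T.norm_map_iff_adjoint_comp_self.mp fun x => ?_
    have hM := (colligation10_schur_complement A B C D hD x (T x) _).mpr ⟨rfl, rfl⟩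
    have hnorm := (colligation10 A B C D).norm_map_iff_adjoint_comp_self.mpr hU1
      (WithLp.toLp 2 (x, Ring.inverse ((1 : U →L[ℂ] U) - D) (C x)))
    rw [hM, ← sq_eq_sq₀ (norm_nonneg _) (norm_nonneg _), WithLp.prod_norm_sq_eq_of_L2,
      WithLp.prod_norm_sq_eq_of_L2] at hnorm
    exact (sq_eq_sq₀ (norm_nonneg _) (norm_nonneg _)).mp (add_right_cancel hnorm)
  have hD' : IsUnit ((1 : U →L[ℂ] U) - ContinuousLinearMap.adjoint D) := by
    simpa [ContinuousLinearMap.star_eq_adjoint] using hD.star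
  refine ⟨hiso, ContinuousLinearMap.ext fun y => ?_⟩
  obtain ⟨x, rfl⟩ : ∃ x, y = T x := by
    have hN := (colligation10_schur_complement (ContinuousLinearMap.adjoint A)
      (ContinuousLinearMap.adjoint C) (ContinuousLinearMap.adjoint B)
      (ContinuousLinearMap.adjoint D) hD' y _ _).mpr ⟨rfl, rfl⟩
    rw [← adjoint_colligation10] at hN
    have hM := congrArg (colligation10 A B C D) hN
    rw [← ContinuousLinearMap.comp_apply, hU2, one_apply_eq_self] at hM
    exact ⟨_, ((colligation10_schur_complement A B C D hD _ _ _).mp hM.symm).2⟩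
  exact congrArg T (DFunLike.congr_fun hiso x)
end

section
/- Let U, X be complex Hilbert spaces, [[A,B],[C,D]] : X ⊕ U → X ⊕ U a bounded colligation matrix with A*A = AA* = I_X, B = AC*, and D + D* = CC*, and let (P_1,…,P_d) be a d-fold spectral decomposition of the identity on X. Then for every ζ ∈ D^d, D + C (I − P(ζ)A)^{-1} P(ζ) B = (1/2)(D − D*) + (1/2) B* (I − A P(ζ))^{-1} (I + A P(ζ)) B. Equivalently, the function F(ζ) := D + C(I − P(ζ)A)^{-1} P(ζ) B has the representation F(ζ) = R + V* (I − AP(ζ))^{-1} (I + AP(ζ)) V, where R := (D − D*)/2 is skew-adjoint and V := (1/√2) B satisfies V*V = (F(0) + F(0)*)/2. -/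
open scoped InnerProductSpace in
/-- For self-adjoint idempotents summing to the identity, the squares of the norms of the
components of a vector add up to the square of its norm. -/
theorem sum_norm_sq_eq_of_isSelfAdjoint_of_isIdempotentElem
    {X ι : Type*} [NormedAddCommGroup X] [InnerProductSpace ℂ X] [CompleteSpace X] [Fintype ι]
    {P : ι → X →L[ℂ] X} (hPsa : ∀ k, IsSelfAdjoint (P k))
    (hPidem : ∀ k, IsIdempotentElem (P k)) (hPsum : ∑ k, P k = 1) (x : X) :
    ∑ k, ‖P k x‖ ^ 2 = ‖x‖ ^ 2 := by
  have key (k : ι) : ⟪P k x, P k x⟫_ℂ = ⟪P k x, x⟫_ℂ := by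
    rw [← ContinuousLinearMap.adjoint_inner_left, (hPsa k).adjoint_eq,
      ← mul_apply_eq_comp, (hPidem k).eq]
  have h : ∑ k, ⟪P k x, P k x⟫_ℂ = ⟪x, x⟫_ℂ := by
    simp_rw [key]
    rw [← sum_inner, ← sum_apply, hPsum, one_apply_eq_self]
  simp_rw [inner_self_eq_norm_sq_to_K] at h
  exact_mod_cast h

open scoped InnerProductSpace in
/-- A combination of the projections of a spectral decomposition of the identity, with
coefficients of modulus at most `r`, has norm at most `r`. -/
theorem norm_sum_smul_le_of_isSelfAdjoint_of_isIdempotentElem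
    {X ι : Type*} [NormedAddCommGroup X] [InnerProductSpace ℂ X] [CompleteSpace X] [Fintype ι]
    {P : ι → X →L[ℂ] X} (hPsa : ∀ k, IsSelfAdjoint (P k))
    (hPidem : ∀ k, IsIdempotentElem (P k)) (hPsum : ∑ k, P k = 1)
    {ζ : ι → ℂ} {r : ℝ} (hr : 0 ≤ r) (hζ : ∀ k, ‖ζ k‖ ≤ r) :
    ‖∑ k, ζ k • P k‖ ≤ r := by
  refine ContinuousLinearMap.opNorm_le_of_re_inner_le hr fun x y hx hy => ?_
  have key (k : ι) : ⟪P k x, y⟫_ℂ = ⟪P k x, P k y⟫_ℂ := by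
    rw [← ContinuousLinearMap.adjoint_inner_left, (hPsa k).adjoint_eq,
      ← mul_apply_eq_comp, (hPidem k).eq]
  have hcs : ∑ k, ‖P k x‖ * ‖P k y‖ ≤ ‖x‖ * ‖y‖ := by
    refine abs_le_of_sq_le_sq' ?_ (by positivity) |>.2
    rw [mul_pow, ← sum_norm_sq_eq_of_isSelfAdjoint_of_isIdempotentElem hPsa hPidem hPsum x,
      ← sum_norm_sq_eq_of_isSelfAdjoint_of_isIdempotentElem hPsa hPidem hPsum y]
    exact Finset.sum_mul_sq_le_sq_mul_sq _ _ _
  calc RCLike.re ⟪(∑ k, ζ k • P k) x, y⟫_ℂ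
      ≤ ‖⟪(∑ k, ζ k • P k) x, y⟫_ℂ‖ := RCLike.re_le_norm _
    _ = ‖∑ k, ⟪ζ k • P k x, y⟫_ℂ‖ := by
        rw [sum_apply, sum_inner]; rfl
    _ ≤ ∑ k, r * (‖P k x‖ * ‖P k y‖) := by
        refine norm_sum_le_of_le _ fun k _ => ?_
        rw [inner_smul_left, key, norm_mul, RCLike.norm_conj]
        exact mul_le_mul (hζ k) (norm_inner_le_norm _ _) (norm_nonneg _) hr
    _ ≤ r * (‖x‖ * ‖y‖) := by
        rw [← Finset.mul_sum]
        exact mul_le_mul_of_nonneg_left hcs hr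
    _ = r := by rw [hx, hy, mul_one, mul_one]

/-- The push-through identity for resolvents in a ring. -/
theorem mul_inverse_one_sub_mul_comm {R : Type*} [Ring R] {a z : R}
    (h₁ : IsUnit (1 - z * a)) (h₂ : IsUnit (1 - a * z)) :
    a * Ring.inverse (1 - z * a) = Ring.inverse (1 - a * z) * a := by
  apply h₂.mul_left_cancel
  apply h₁.mul_right_cancel
  rw [Ring.mul_inverse_cancel_left _ _ h₂, mul_assoc, Ring.inverse_mul_cancel_right _ _ h₁]
  noncomm_ring

/-- The Cayley transform in terms of the resolvent. -/
theorem inverse_one_sub_mul_one_add {R : Type*} [Ring R] {t : R} (h : IsUnit (1 - t)) :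
    Ring.inverse (1 - t) * (1 + t) = 1 + 2 * (Ring.inverse (1 - t) * t) := by
  have h' : 1 + t = (1 - t) + 2 * t := by noncomm_ring
  rw [h', mul_add, Ring.inverse_mul_cancel _ h]
  noncomm_ring


/-- **Cayley–Herglotz rewriting of the polydisk Herglotz realization formula.**
Let `[[A,B],[C,D]] : X ⊕ U → X ⊕ U` be a bounded colligation with `A* A = A A* = I`,
`B = A C*`, `D + D* = C C*`, and let `(P 0, …, P (d-1))` be a `d`-fold spectral
decomposition of the identity on `X`; write `P(ζ) = ∑ k, ζ k • P k`.  Then for every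
`ζ` in the unit polydisk `I − P(ζ)A` and `I − AP(ζ)` are boundedly invertible and
`D + C (I − P(ζ)A)⁻¹ P(ζ) B = (1/2)(D − D*) + (1/2) B* (I − AP(ζ))⁻¹ (I + AP(ζ)) B`;
equivalently `F(ζ) = R + V* (I − AP(ζ))⁻¹ (I + AP(ζ)) V` with `R = (D − D*)/2`
skew-adjoint and `V = (1/√2) B` satisfying `V* V = (F(0) + F(0)*)/2`. -/
theorem herglotz_realization_symmetrized
    {X U : Type*} [NormedAddCommGroup X] [InnerProductSpace ℂ X] [CompleteSpace X]
    [NormedAddCommGroup U] [InnerProductSpace ℂ U] [CompleteSpace U]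
    (d : ℕ) (A : X →L[ℂ] X) (B : U →L[ℂ] X) (C : X →L[ℂ] U) (D : U →L[ℂ] U)
    (hA1 : ContinuousLinearMap.adjoint A * A = 1)
    (hA2 : A * ContinuousLinearMap.adjoint A = 1)
    (hB : B = A ∘L ContinuousLinearMap.adjoint C)
    (hD : D + ContinuousLinearMap.adjoint D = C ∘L ContinuousLinearMap.adjoint C)
    (P : Fin d → X →L[ℂ] X)
    (hPsa : ∀ k, IsSelfAdjoint (P k))
    (hPidem : ∀ k, IsIdempotentElem (P k))
    (hPsum : ∑ k, P k = 1) :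
    (∀ ζ : Fin d → ℂ, (∀ k, ‖ζ k‖ < 1) →
      IsUnit ((1 : X →L[ℂ] X) - (∑ k, ζ k • P k) * A) ∧
      IsUnit ((1 : X →L[ℂ] X) - A * (∑ k, ζ k • P k)) ∧
      D + C ∘L Ring.inverse ((1 : X →L[ℂ] X) - (∑ k, ζ k • P k) * A) ∘L
          ((∑ k, ζ k • P k) ∘L B) =
        (2⁻¹ : ℂ) • (D - ContinuousLinearMap.adjoint D) +
        (2⁻¹ : ℂ) • (ContinuousLinearMap.adjoint B ∘L
          Ring.inverse ((1 : X →L[ℂ] X) - A * (∑ k, ζ k • P k)) ∘L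
          ((1 : X →L[ℂ] X) + A * (∑ k, ζ k • P k)) ∘L B)) ∧
    ((2⁻¹ : ℂ) • (ContinuousLinearMap.adjoint B ∘L B) =
      (2⁻¹ : ℂ) • (D + ContinuousLinearMap.adjoint D)) := by
  have hBadj : ContinuousLinearMap.adjoint B =
      C ∘L ContinuousLinearMap.adjoint A := by
    rw [hB, ContinuousLinearMap.adjoint_comp, ContinuousLinearMap.adjoint_adjoint]
  have hC : C = ContinuousLinearMap.adjoint B ∘L A := by
    rw [hBadj, ContinuousLinearMap.comp_assoc, ← ContinuousLinearMap.mul_def, hA1]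
    rfl
  have hBB : ContinuousLinearMap.adjoint B ∘L B = D + ContinuousLinearMap.adjoint D := by
    rw [hD, hBadj, hB, ContinuousLinearMap.comp_assoc, ← ContinuousLinearMap.comp_assoc _ A,
      ← ContinuousLinearMap.mul_def (ContinuousLinearMap.adjoint A) A, hA1]
    rfl
  refine ⟨fun ζ hζ => ?_, by rw [hBB]⟩
  have hA : ‖A‖ ≤ 1 := by
    refine ContinuousLinearMap.opNorm_le_bound _ zero_le_one fun x => ?_
    rw [one_mul, ContinuousLinearMap.norm_map_of_mem_unitary (Unitary.mem_iff.2 ⟨hA1, hA2⟩)]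
  have hZ : ‖∑ k, ζ k • P k‖ < 1 := by
    have hr : Finset.univ.sup (fun k => ‖ζ k‖₊) < 1 :=
      (Finset.sup_lt_iff (by simp)).2 fun k _ => hζ k
    refine lt_of_le_of_lt (norm_sum_smul_le_of_isSelfAdjoint_of_isIdempotentElem hPsa hPidem
      hPsum (NNReal.coe_nonneg _) fun k => ?_) (NNReal.coe_lt_coe.2 hr)
    exact_mod_cast Finset.le_sup (f := fun k => ‖ζ k‖₊) (Finset.mem_univ k)
  generalize ∑ k, ζ k • P k = Z at hZ ⊢
  have h₁ : IsUnit (1 - Z * A) := isUnit_one_sub_of_norm_lt_one <|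
    (norm_mul_le _ _).trans_lt (mul_lt_one_of_nonneg_of_lt_one_left (norm_nonneg _) hZ hA)
  have h₂ : IsUnit (1 - A * Z) := isUnit_one_sub_of_norm_lt_one <|
    (norm_mul_le _ _).trans_lt (mul_lt_one_of_nonneg_of_lt_one_right hA (norm_nonneg _) hZ)
  refine ⟨h₁, h₂, ?_⟩
  have push := mul_inverse_one_sub_mul_comm h₁ h₂
  have cayley := inverse_one_sub_mul_one_add h₂
  generalize Ring.inverse (1 - Z * A) = W₁ at push ⊢
  generalize Ring.inverse (1 - A * Z) = W₂ at push cayley ⊢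
  have hL : C ∘L W₁ ∘L (Z ∘L B) = ContinuousLinearMap.adjoint B ∘L (W₂ * (A * Z)) ∘L B := by
    rw [← mul_assoc, ← push, hC]
    rfl
  have hR : ContinuousLinearMap.adjoint B ∘L W₂ ∘L (1 + A * Z) ∘L B =
      D + ContinuousLinearMap.adjoint D +
        (2 : ℂ) • (ContinuousLinearMap.adjoint B ∘L (W₂ * (A * Z)) ∘L B) := by
    rw [← hBB, ← ContinuousLinearMap.comp_assoc _ _ B, ← ContinuousLinearMap.mul_def, cayley,
      two_mul, two_smul]
    simp only [ContinuousLinearMap.add_comp, ContinuousLinearMap.comp_add]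
    rfl
  rw [hL, hR]
  module
end

section
/- Let X, U be complex Hilbert spaces and let W = [[A, B],[B*, D]] : X ⊕ U → X ⊕ U be a bounded block operator that is both unitary and self-adjoint (so W = W* = W^{-1}; in particular A = A*, D = D*), and suppose I_U − D is boundedly invertible. Then U₀ := A + B (I − D)^{-1} B* ∈ L(X) is both unitary and self-adjoint (so X is the orthogonal direct sum of the eigenspaces ker(U₀ − I) and ker(U₀ + I)), and Ran B ⊆ ker(U₀ − I); equivalently, the (−1)-eigenspace of U₀ is orthogonal to the range of B. -/
/-- The block operator `[[A,B],[B*,D]]` on the Hilbert direct sum `X ⊕ U`, realized via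
`WithLp 2` products. -/
noncomputable def colligation18 {X U : Type*}
    [NormedAddCommGroup X] [InnerProductSpace ℂ X] [CompleteSpace X]
    [NormedAddCommGroup U] [InnerProductSpace ℂ U] [CompleteSpace U]
    (A : X →L[ℂ] X) (B : U →L[ℂ] X) (D : U →L[ℂ] U) :
    WithLp 2 (X × U) →L[ℂ] WithLp 2 (X × U) :=
  (((WithLp.prodContinuousLinearEquiv 2 ℂ X U).symm : (X × U) →L[ℂ] WithLp 2 (X × U)) ∘L
    (((A ∘L ContinuousLinearMap.fst ℂ X U) + (B ∘L ContinuousLinearMap.snd ℂ X U)).prod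
      ((ContinuousLinearMap.adjoint B ∘L ContinuousLinearMap.fst ℂ X U) +
        (D ∘L ContinuousLinearMap.snd ℂ X U)))) ∘L
    ((WithLp.prodContinuousLinearEquiv 2 ℂ X U) : WithLp 2 (X × U) →L[ℂ] (X × U))

section

variable {X U : Type*}
  [NormedAddCommGroup X] [InnerProductSpace ℂ X] [CompleteSpace X]
  [NormedAddCommGroup U] [InnerProductSpace ℂ U] [CompleteSpace U]
  {A : X →L[ℂ] X} {B : U →L[ℂ] X} {D : U →L[ℂ] U}

open ContinuousLinearMap (adjoint)

theorem colligation18_toLp (x : X) (u : U) :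
    colligation18 A B D (WithLp.toLp 2 (x, u)) =
      WithLp.toLp 2 (A x + B u, adjoint B x + D u) := rfl

theorem adjoint_eq_self_of_adjoint_colligation18_eq
    (h : adjoint (colligation18 A B D) = colligation18 A B D) :
    adjoint A = A ∧ adjoint D = D := by
  have key (p q : WithLp 2 (X × U)) :
      inner ℂ (colligation18 A B D p) q = inner ℂ p (colligation18 A B D q) := by
    conv_lhs => rw [← h]
    exact ContinuousLinearMap.adjoint_inner_left _ _ _
  refine ⟨((ContinuousLinearMap.eq_adjoint_iff A A).2 fun x y => ?_).symm,
    ((ContinuousLinearMap.eq_adjoint_iff D D).2 fun u v => ?_).symm⟩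
  · simpa [colligation18_toLp, WithLp.prod_inner_apply] using
      key (WithLp.toLp 2 (x, 0)) (WithLp.toLp 2 (y, 0))
  · simpa [colligation18_toLp, WithLp.prod_inner_apply] using
      key (WithLp.toLp 2 (0, u)) (WithLp.toLp 2 (0, v))

theorem block_relations_of_colligation18_mul_self
    (h : colligation18 A B D * colligation18 A B D = 1) :
    (∀ x, A (A x) + B (adjoint B x) = x) ∧ (∀ x, adjoint B (A x) + D (adjoint B x) = 0) ∧
      (∀ u, A (B u) + B (D u) = 0) ∧ ∀ u, adjoint B (B u) + D (D u) = u := by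
  have key (x : X) (u : U) := congrArg WithLp.ofLp (DFunLike.congr_fun h (WithLp.toLp 2 (x, u)))
  simp only [mul_apply_eq_comp, one_apply_eq_self, colligation18_toLp,
    Prod.mk.injEq] at key
  exact ⟨fun x => by simpa using (key x 0).1, fun x => by simpa using (key x 0).2,
    fun u => by simpa using (key 0 u).1, fun u => by simpa using (key 0 u).2⟩

end

/-- **Schur-complement rotation of a selfadjoint unitary colligation.**
Let `W = [[A,B],[B*,D]] : X ⊕ U → X ⊕ U` be both unitary and self-adjoint, and suppose
`I − D` is boundedly invertible.  Then `U₀ := A + B (I − D)⁻¹ B*` is both unitary and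
self-adjoint, and `Ran B ⊆ ker (U₀ − I)`, i.e. `U₀ (B u) = B u` for all `u ∈ U`. -/
theorem selfadjoint_unitary_colligation_rotation
    {X U : Type*} [NormedAddCommGroup X] [InnerProductSpace ℂ X] [CompleteSpace X]
    [NormedAddCommGroup U] [InnerProductSpace ℂ U] [CompleteSpace U]
    (A : X →L[ℂ] X) (B : U →L[ℂ] X) (D : U →L[ℂ] U)
    (hsa : ContinuousLinearMap.adjoint (colligation18 A B D) = colligation18 A B D)
    (hU1 : ContinuousLinearMap.adjoint (colligation18 A B D) * colligation18 A B D = 1)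
    (hU2 : colligation18 A B D * ContinuousLinearMap.adjoint (colligation18 A B D) = 1)
    (hD : IsUnit ((1 : U →L[ℂ] U) - D)) :
    ContinuousLinearMap.adjoint
        (A + B ∘L Ring.inverse ((1 : U →L[ℂ] U) - D) ∘L ContinuousLinearMap.adjoint B) =
      A + B ∘L Ring.inverse ((1 : U →L[ℂ] U) - D) ∘L ContinuousLinearMap.adjoint B ∧
    ContinuousLinearMap.adjoint
        (A + B ∘L Ring.inverse ((1 : U →L[ℂ] U) - D) ∘L ContinuousLinearMap.adjoint B) *
      (A + B ∘L Ring.inverse ((1 : U →L[ℂ] U) - D) ∘L ContinuousLinearMap.adjoint B) = 1 ∧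
    (A + B ∘L Ring.inverse ((1 : U →L[ℂ] U) - D) ∘L ContinuousLinearMap.adjoint B) *
      ContinuousLinearMap.adjoint
        (A + B ∘L Ring.inverse ((1 : U →L[ℂ] U) - D) ∘L ContinuousLinearMap.adjoint B) = 1 ∧
    ∀ u : U,
      (A + B ∘L Ring.inverse ((1 : U →L[ℂ] U) - D) ∘L ContinuousLinearMap.adjoint B) (B u) =
        B u := by
  obtain ⟨hA, hD'⟩ := adjoint_eq_self_of_adjoint_colligation18_eq hsa
  rw [hsa] at hU1
  obtain ⟨h11, h21, h12, h22⟩ := block_relations_of_colligation18_mul_self hU1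
  have hR : ContinuousLinearMap.adjoint (Ring.inverse ((1 : U →L[ℂ] U) - D)) =
      Ring.inverse ((1 : U →L[ℂ] U) - D) := by
    rw [← ContinuousLinearMap.star_eq_adjoint, ← Ring.inverse_star, star_sub, star_one,
      ContinuousLinearMap.star_eq_adjoint, hD']
  have hinv (u : U) : Ring.inverse ((1 : U →L[ℂ] U) - D) (u - D u) = u :=
    DFunLike.congr_fun (Ring.inverse_mul_cancel _ hD) u
  generalize Ring.inverse ((1 : U →L[ℂ] U) - D) = R at hR hinv ⊢
  have hadj : ContinuousLinearMap.adjoint (A + B ∘L R ∘L ContinuousLinearMap.adjoint B) =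
      A + B ∘L R ∘L ContinuousLinearMap.adjoint B := by
    simp only [map_add, ContinuousLinearMap.adjoint_comp, ContinuousLinearMap.adjoint_adjoint,
      hA, hR, ContinuousLinearMap.comp_assoc]
  have hfix (u : U) : (A + B ∘L R ∘L ContinuousLinearMap.adjoint B) (B u) = B u := by
    have hBB : ContinuousLinearMap.adjoint B (B u) = (u + D u) - D (u + D u) := by
      rw [eq_sub_of_add_eq (h22 u), map_add]
      abel
    simp only [add_apply, ContinuousLinearMap.comp_apply]
    rw [hBB, hinv, eq_neg_of_add_eq_zero_left (h12 u), map_add]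
    abel
  have hsq : (A + B ∘L R ∘L ContinuousLinearMap.adjoint B) *
      (A + B ∘L R ∘L ContinuousLinearMap.adjoint B) = 1 := by
    ext x
    calc (A + B ∘L R ∘L ContinuousLinearMap.adjoint B)
          (A x + B (R (ContinuousLinearMap.adjoint B x)))
        = A (A x) + B (R (ContinuousLinearMap.adjoint B x -
            D (ContinuousLinearMap.adjoint B x))) := by
          rw [map_add, hfix]
          simp only [add_apply, ContinuousLinearMap.comp_apply]
          rw [eq_neg_of_add_eq_zero_left (h21 x)]
          simp only [map_neg, map_sub]
          abel
      _ = x := by rw [hinv, h11]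
  rw [hadj]
  exact ⟨rfl, hsq, hsq, hfix⟩
end
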